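/- Let U ⊆ ℝ^N be open and let μ^1, ..., μ^N : U → ℝ be smooth functions, and consider the diagonal affinor w^i_j(u) = μ^i(u) δ^i_j. Then the Nijenhuis tensor of w vanishes identically on U if and only if for every u ∈ U and all indices i, j with μ^i(u) ≠ μ^j(u) one has ∂μ^i/∂u^j (u) = 0. -/

import Mathlib

/-- Partial derivative `∂f/∂u^j` of a scalar function on `ℝ^N`. -/
noncomputable def pd {N : ℕ} (f : (Fin N → ℝ) → ℝ) (j : Fin N) (u : Fin N → ℝ) : ℝ :=
  fderiv ℝ f u (Pi.single j 1)

/-- The Nijenhuis tensor `N^k_{ij}` of an affinor `v^i_j(u)` on `ℝ^N`. -/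
noncomputable def nijenhuisT {N : ℕ} (v : (Fin N → ℝ) → Matrix (Fin N) (Fin N) ℝ)
    (k i j : Fin N) (u : Fin N → ℝ) : ℝ :=
  ∑ s, (v u s i * pd (fun w => v w k j) s u - v u s j * pd (fun w => v w k i) s u +
        v u k s * pd (fun w => v w s i) j u - v u k s * pd (fun w => v w s j) i u)

theorem pd_diag_aux {N : ℕ} (μ : Fin N → (Fin N → ℝ) → ℝ) (a b s : Fin N) (u : Fin N → ℝ) :
    pd (fun w => (Matrix.diagonal fun s => μ s w : Matrix (Fin N) (Fin N) ℝ) a b) s u =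
      if a = b then pd (μ a) s u else 0 := by
  by_cases h : a = b
  · subst h
    simp
  · simp [h, pd]

theorem nij_diag_aux {N : ℕ} (μ : Fin N → (Fin N → ℝ) → ℝ) (k i j : Fin N) (u : Fin N → ℝ) :
    nijenhuisT (fun w => Matrix.diagonal fun s => μ s w) k i j u =
      (if k = j then (μ i u - μ j u) * pd (μ j) i u else 0) +
      (if k = i then (μ i u - μ j u) * pd (μ i) j u else 0) := by
  unfold nijenhuisT
  simp only [pd_diag_aux]
  simp only [Matrix.diagonal_apply, Finset.sum_add_distrib, Finset.sum_sub_distrib, ite_mul,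
    zero_mul, Finset.sum_ite_eq, Finset.sum_ite_eq', Finset.mem_univ, if_true]
  by_cases h1 : k = j <;> by_cases h2 : k = i
  · subst h1
    subst h2
    simp
  · subst h1
    simp [h2]
    ring
  · subst h2
    simp [h1]
    ring
  · simp [h1, h2]

/-- **Lemma 2, part 3.** For a diagonal affinor `w^i_j(u) = μ^i(u) δ^i_j` on an open set `U`, the
Nijenhuis tensor vanishes identically on `U` iff `∂μ^i/∂u^j(u) = 0` whenever `μ^i(u) ≠ μ^j(u)`. -/
theorem nijenhuis_of_diagonal_affinor_vanishes_iff {N : ℕ}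
    (U : Set (Fin N → ℝ)) (hU : IsOpen U)
    (μ : Fin N → (Fin N → ℝ) → ℝ)
    (hμsm : ∀ i, ContDiffOn ℝ (⊤ : ℕ∞) (μ i) U) :
    (∀ u ∈ U, ∀ k i j : Fin N,
        nijenhuisT (fun w => Matrix.diagonal fun s => μ s w) k i j u = 0) ↔
      (∀ u ∈ U, ∀ i j : Fin N, μ i u ≠ μ j u → pd (μ i) j u = 0) := by
  constructor
  · intro h u hu i j hij
    have h1 := h u hu i i j
    have hne : i ≠ j := fun e => hij (by rw [e])
    rw [nij_diag_aux, if_neg hne, if_pos rfl, zero_add] at h1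
    exact (mul_eq_zero.mp h1).resolve_left (sub_ne_zero.mpr hij)
  · intro h u hu k i j
    rw [nij_diag_aux]
    by_cases e : μ i u = μ j u
    · simp [e]
    · rw [h u hu i j e, h u hu j i (Ne.symm e)]
      simp
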